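/- arXiv:0706.0119 — 4 statements merged into one kernel-verified Lean document; each statement's English description precedes it below -/
import Mathlib

section
/- Let a > 0 and X ∈ ℝ with −√a < X < √a, and set A = a − X². Then (4/3)·∫_X^{√a} ((3a + 2x²)/5)·(a − x²)^{3/2} dx = (2a/3)·V(a,X) + (4X/45)·A^{5/2}, where V(a,X) = (a²/2)·(π/2 − arctan(X/√A)) + ((2X³ − 5aX)/6)·√A. -/
open Real MeasureTheory

lemma hasDerivAt_sqrt_sq_sub_sq {r x : ℝ} (hx : 0 < r ^ 2 - x ^ 2) :
    HasDerivAt (fun x : ℝ => √(r ^ 2 - x ^ 2)) (-x / √(r ^ 2 - x ^ 2)) x := by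
  have h := (((hasDerivAt_id x).pow 2).const_sub (r ^ 2)).sqrt hx.ne'
  refine h.congr_deriv ?_
  have := (sqrt_pos.2 hx).ne'
  simp only [id, Pi.pow_apply]
  field_simp
  simp

lemma sqrt_one_sub_div_sq {r : ℝ} (hr : 0 < r) (x : ℝ) :
    √(1 - (x / r) ^ 2) = √(r ^ 2 - x ^ 2) / r := by
  rw [show 1 - (x / r) ^ 2 = (r ^ 2 - x ^ 2) / r ^ 2 by field_simp,
    sqrt_div' _ (sq_nonneg r), sqrt_sq hr.le]

lemma hasDerivAt_arcsin_div {r x : ℝ} (hr : 0 < r) (h1 : -r < x) (h2 : x < r) :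
    HasDerivAt (fun x : ℝ => arcsin (x / r)) (1 / √(r ^ 2 - x ^ 2)) x := by
  have hlt : x / r < 1 := (div_lt_one hr).2 h2
  have hgt : -1 < x / r := by rw [lt_div_iff₀ hr]; linarith
  have h := (hasDerivAt_arcsin hgt.ne' hlt.ne).comp x ((hasDerivAt_id x).div_const r)
  refine h.congr_deriv ?_
  rw [sqrt_one_sub_div_sq hr]
  field_simp

lemma arcsin_div_eq_arctan {r x : ℝ} (hr : 0 < r) (h1 : -r < x) (h2 : x < r) :
    arcsin (x / r) = arctan (x / √(r ^ 2 - x ^ 2)) := by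
  have hlt : x / r < 1 := (div_lt_one hr).2 h2
  have hgt : -1 < x / r := by rw [lt_div_iff₀ hr]; linarith
  rw [arcsin_eq_arctan ⟨hgt, hlt⟩, sqrt_one_sub_div_sq hr, div_div_div_cancel_right₀ hr.ne']

lemma rpow_three_halves {t : ℝ} (ht : 0 ≤ t) : t ^ ((3 : ℝ) / 2) = t * √t := by
  rw [show (3 : ℝ) / 2 = 1 + 1 / 2 by norm_num, rpow_add_of_nonneg ht (by norm_num) (by norm_num),
    rpow_one, ← sqrt_eq_rpow]

lemma rpow_five_halves {t : ℝ} (ht : 0 ≤ t) : t ^ ((5 : ℝ) / 2) = t ^ 2 * √t := by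
  rw [show (5 : ℝ) / 2 = 2 + 1 / 2 by norm_num, rpow_add_of_nonneg ht (by norm_num) (by norm_num),
    rpow_two, ← sqrt_eq_rpow]

lemma hasDerivAt_sector_moment {r x : ℝ} (hr : 0 < r) (h1 : -r < x) (h2 : x < r) :
    HasDerivAt (fun x : ℝ => 2 * r ^ 2 / 3 * ((r ^ 2) ^ 2 / 2 * (π / 2 - arcsin (x / r)) +
        (2 * x ^ 3 - 5 * r ^ 2 * x) / 6 * √(r ^ 2 - x ^ 2)) +
        4 * x / 45 * ((r ^ 2 - x ^ 2) ^ 2 * √(r ^ 2 - x ^ 2)))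
      (-(4 / 3) * ((3 * r ^ 2 + 2 * x ^ 2) / 5 * (r ^ 2 - x ^ 2) ^ ((3 : ℝ) / 2))) x := by
  have hA : 0 < r ^ 2 - x ^ 2 := by nlinarith
  have hs := hasDerivAt_sqrt_sq_sub_sq hA
  have hx := hasDerivAt_id' x
  have hV := (((hasDerivAt_arcsin_div hr h1 h2).const_sub (π / 2)).const_mul ((r ^ 2) ^ 2 / 2)).add
    (((((hx.pow 3).const_mul 2).sub (hx.const_mul (5 * r ^ 2))).div_const 6).mul hs)
  have hW := ((hx.const_mul 4).div_const 45).mul ((((hx.pow 2).const_sub (r ^ 2)).pow 2).mul hs)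
  refine ((hV.const_mul (2 * r ^ 2 / 3)).add hW).congr_deriv ?_
  rw [rpow_three_halves hA.le]
  have hpos := sqrt_pos.2 hA
  have hsq := sq_sqrt hA.le
  simp only [Pi.pow_apply, Pi.mul_apply, Pi.sub_apply]
  generalize √(r ^ 2 - x ^ 2) = s at *
  field_simp
  rw [hsq]
  push_cast
  ring

theorem stmt_2 (a X : ℝ) (ha : 0 < a)
    (h1 : -Real.sqrt a < X) (h2 : X < Real.sqrt a)
    (A : ℝ) (hA : A = a - X ^ 2)
    (V : ℝ)
    (hV : V = a ^ 2 / 2 * (π / 2 - Real.arctan (X / Real.sqrt A)) +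
        (2 * X ^ 3 - 5 * a * X) / 6 * Real.sqrt A) :
    (4 / 3) * ∫ x in X..Real.sqrt a, (3 * a + 2 * x ^ 2) / 5 * (a - x ^ 2) ^ ((3 : ℝ) / 2) =
      2 * a / 3 * V + 4 * X / 45 * A ^ ((5 : ℝ) / 2) := by
  obtain ⟨r, hr, rfl⟩ : ∃ r : ℝ, 0 < r ∧ a = r ^ 2 :=
    ⟨√a, sqrt_pos.2 ha, (sq_sqrt ha.le).symm⟩
  rw [sqrt_sq hr.le] at *
  have hA0 : 0 ≤ r ^ 2 - X ^ 2 := by nlinarith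
  have hcont : Continuous fun x : ℝ =>
      (3 * r ^ 2 + 2 * x ^ 2) / 5 * (r ^ 2 - x ^ 2) ^ ((3 : ℝ) / 2) := by
    refine Continuous.mul (by fun_prop) (Continuous.rpow_const (by fun_prop) fun x => ?_)
    right; norm_num
  have key := intervalIntegral.integral_eq_sub_of_hasDerivAt_of_le h2.le
    (Continuous.continuousOn (by fun_prop))
    (fun x hx => hasDerivAt_sector_moment hr (h1.trans hx.1) hx.2)
    ((hcont.const_mul (-(4 / 3))).intervalIntegrable _ _)
  rw [intervalIntegral.integral_const_mul, arcsin_div_eq_arctan hr h1 h2] at key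
  simp only [div_self hr.ne', arcsin_one, sub_self, sqrt_zero, mul_zero, add_zero] at key
  subst hA hV
  rw [rpow_five_halves hA0]
  linarith
end

section
/- Let a > 0, X ∈ ℝ with −√a < X < √a, b < 0, and c = a − bX. Then the Lebesgue measure (volume) of the submerged part 𝒫' = {(x,y,z) ∈ ℝ³ : x² + y² ≤ z, z ≤ a, z ≥ bx + c} equals V₁ − V₂, where V₁ = V(a,X), V₂ = V(a',X'), with X' = X − b/2, a' = b²/4 − bX + a, A = a − X², and V(α,ξ) = (α²/2)(π/2 − arctan(ξ/√A)) + ((2ξ³ − 5αξ)/6)·√A evaluated with the common value A = a − X² = a' − X'². -/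
open Real MeasureTheory

theorem lintegral_eq_ofReal_intervalIntegral {F : ℝ → ENNReal} {f : ℝ → ℝ} {p q : ℝ}
    (hpq : p ≤ q) (hf : Continuous f) (h0 : ∀ x ∈ Set.Icc p q, 0 ≤ f x)
    (hin : ∀ x ∈ Set.Icc p q, F x = ENNReal.ofReal (f x))
    (hout : ∀ x, x ∉ Set.Icc p q → F x = 0) :
    ∫⁻ x, F x = ENNReal.ofReal (∫ x in p..q, f x) := by
  have hF : F = (Set.Icc p q).indicator F := by
    symm
    rw [Set.indicator_eq_self]
    intro x hx
    by_contra h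
    exact hx (hout x h)
  rw [hF, lintegral_indicator measurableSet_Icc, setLIntegral_congr_fun measurableSet_Icc hin,
    intervalIntegral.integral_of_le hpq, ← integral_Icc_eq_integral_Ioc,
    ofReal_integral_eq_lintegral_ofReal hf.continuousOn.integrableOn_Icc]
  exact (ae_restrict_iff' measurableSet_Icc).2 (Filter.Eventually.of_forall h0)

theorem lintegral_ofReal_sub_sq (r : ℝ) :
    ∫⁻ y : ℝ, ENNReal.ofReal (r - y ^ 2) = ENNReal.ofReal (4 / 3 * (r * √r)) := by
  rcases le_total r 0 with hr | hr
  · simp only [Real.sqrt_eq_zero_of_nonpos hr, mul_zero, ENNReal.ofReal_zero]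
    rw [← lintegral_zero (μ := (volume : Measure ℝ))]
    congr 1
    ext y
    exact ENNReal.ofReal_of_nonpos (by nlinarith [sq_nonneg y])
  · have hs := Real.sqrt_nonneg r
    have hs2 := Real.sq_sqrt hr
    rw [lintegral_eq_ofReal_intervalIntegral (p := -√r) (q := √r) (f := fun y ↦ r - y ^ 2)
      (by linarith) (by fun_prop)]
    · congr 1
      rw [intervalIntegral.integral_sub (by simp) (by simp)]
      simp only [intervalIntegral.integral_const, integral_pow, smul_eq_mul]
      push_cast
      linear_combination (-2 / 3 * √r) * hs2
    · intro y hy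
      nlinarith [hy.1, hy.2]
    · intro y _
      rfl
    · intro y hy
      refine ENNReal.ofReal_of_nonpos ?_
      by_contra! h
      exact hy (abs_le.1 (Real.abs_le_sqrt (by linarith)))

theorem integral_sub_sq_mul_sqrt {α ξ : ℝ} (h : ξ ^ 2 < α) :
    ∫ u in ξ..√α, 4 / 3 * ((α - u ^ 2) * √(α - u ^ 2)) =
      α ^ 2 / 2 * (π / 2 - arctan (ξ / √(α - ξ ^ 2))) +
        (2 * ξ ^ 3 - 5 * α * ξ) / 6 * √(α - ξ ^ 2) := by
  have hα : 0 < α := lt_of_le_of_lt (sq_nonneg ξ) h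
  have hs : 0 < √α := Real.sqrt_pos.2 hα
  have hs2 := Real.sq_sqrt hα.le
  have hξ := Real.sq_lt.1 h
  have scale : ∀ u : ℝ, √(1 - (u / √α) ^ 2) = √(α - u ^ 2) / √α := by
    intro u
    rw [← Real.sqrt_div' _ hα.le, div_pow, hs2]
    congr 1
    field_simp
  have harc : arcsin (ξ / √α) = arctan (ξ / √(α - ξ ^ 2)) := by
    rw [Real.arcsin_eq_arctan, scale, div_div_div_cancel_right₀ hs.ne']
    constructor
    · rw [lt_div_iff₀ hs]; linarith
    · rw [div_lt_iff₀ hs]; linarith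
  rw [intervalIntegral.integral_eq_sub_of_hasDerivAt_of_le (f := fun u ↦
    α ^ 2 / 2 * arcsin (u / √α) - (2 * u ^ 3 - 5 * α * u) / 6 * √(α - u ^ 2)) hξ.2.le]
  · simp only [hs2, div_self hs.ne', arcsin_one, sub_self, Real.sqrt_zero, harc]
    ring
  · fun_prop
  · intro u hu
    have hu1 : -√α < u := hξ.1.trans hu.1
    have hupos : 0 < α - u ^ 2 := by nlinarith [hu.2]
    have ht : 0 < √(α - u ^ 2) := Real.sqrt_pos.2 hupos
    have ht2 := Real.sq_sqrt hupos.le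
    have hd1 : HasDerivAt (fun u : ℝ ↦ arcsin (u / √α)) (1 / √(α - u ^ 2)) u := by
      have := (Real.hasDerivAt_arcsin (x := u / √α)
        (by rw [ne_eq, div_eq_iff hs.ne']; linarith)
        (by rw [ne_eq, div_eq_iff hs.ne']; linarith [hu.2])).comp u
          ((hasDerivAt_id u).div_const (√α))
      rw [scale] at this
      refine this.congr_deriv ?_
      field_simp
    have hd2 : HasDerivAt (fun u : ℝ ↦ √(α - u ^ 2)) (-u / √(α - u ^ 2)) u := by
      refine ((((hasDerivAt_id u).pow 2).const_sub α).sqrt hupos.ne').congr_deriv ?_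
      simp
      field_simp
    have hd3 : HasDerivAt (fun u : ℝ ↦ (2 * u ^ 3 - 5 * α * u) / 6)
        ((6 * u ^ 2 - 5 * α) / 6) u := by
      refine (((((hasDerivAt_id u).pow 3).const_mul 2).sub
        ((hasDerivAt_id u).const_mul (5 * α))).div_const 6).congr_deriv ?_
      simp
      ring
    refine ((hd1.const_mul (α ^ 2 / 2)).sub (hd3.mul hd2)).congr_deriv ?_
    set t := √(α - u ^ 2)
    have hαt : α = t ^ 2 + u ^ 2 := by linarith
    rw [← ht2]
    field_simp
    rw [hαt]
    ring
  · exact Continuous.intervalIntegrable (by fun_prop) _ _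

/-- The volume of the part `x ≥ X` of the paraboloid segment lying below the plane
`z = α - h ^ 2 + 2 * h * x`, with the boundary conventions left open. -/
theorem volume_paraboloid_segment {P : Set (ℝ × ℝ × ℝ)} (hP : MeasurableSet P) {α h X : ℝ}
    (hX : (X - h) ^ 2 < α)
    (hslice : ∀ x y : ℝ, volume {z : ℝ | (x, y, z) ∈ P} =
      if X ≤ x then ENNReal.ofReal (α - (x - h) ^ 2 - y ^ 2) else 0) :
    volume P ≠ ⊤ ∧ (volume P).toReal =
      α ^ 2 / 2 * (π / 2 - arctan ((X - h) / √(α - (X - h) ^ 2))) +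
        (2 * (X - h) ^ 3 - 5 * α * (X - h)) / 6 * √(α - (X - h) ^ 2) := by
  have hα : 0 < α := lt_of_le_of_lt (sq_nonneg _) hX
  have hs2 := Real.sq_sqrt hα.le
  have hξ := Real.sq_lt.1 hX
  have hpq : X ≤ √α + h := by linarith [hξ.2]
  have hnonneg : ∀ x ∈ Set.Icc X (√α + h),
      0 ≤ 4 / 3 * ((α - (x - h) ^ 2) * √(α - (x - h) ^ 2)) := by
    intro x hx
    have : 0 ≤ α - (x - h) ^ 2 := by nlinarith [hx.1, hx.2, hξ.1]
    positivity
  have harea : ∀ x : ℝ, volume (Prod.mk x ⁻¹' P) =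
      if X ≤ x then ENNReal.ofReal (4 / 3 * ((α - (x - h) ^ 2) * √(α - (x - h) ^ 2))) else 0 := by
    intro x
    rw [Measure.volume_eq_prod, Measure.prod_apply (measurable_prodMk_left hP)]
    calc _ = ∫⁻ y : ℝ, if X ≤ x then ENNReal.ofReal (α - (x - h) ^ 2 - y ^ 2) else 0 :=
          lintegral_congr (hslice x)
      _ = _ := by
        split_ifs
        · exact lintegral_ofReal_sub_sq _
        · simp
  have hvol : volume P = ENNReal.ofReal
      (∫ x in X..(√α + h), 4 / 3 * ((α - (x - h) ^ 2) * √(α - (x - h) ^ 2))) := by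
    rw [Measure.volume_eq_prod, Measure.prod_apply hP]
    refine lintegral_eq_ofReal_intervalIntegral hpq (by fun_prop) hnonneg ?_ ?_
    · intro x hx
      rw [harea, if_pos hx.1]
    · intro x hx
      rw [harea]
      split_ifs with hXx
      · have hq : √α + h < x := by
          by_contra! hle
          exact hx ⟨hXx, hle⟩
        have : α - (x - h) ^ 2 ≤ 0 := by nlinarith [Real.sqrt_nonneg α]
        simp [Real.sqrt_eq_zero_of_nonpos this]
      · rfl
  rw [hvol]
  refine ⟨ENNReal.ofReal_ne_top, ?_⟩
  rw [ENNReal.toReal_ofReal (intervalIntegral.integral_nonneg hpq hnonneg),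
    intervalIntegral.integral_comp_sub_right
      (fun u ↦ 4 / 3 * ((α - u ^ 2) * √(α - u ^ 2))) h, add_sub_cancel_right,
    integral_sub_sq_mul_sqrt hX]

theorem stmt_5 (a X b : ℝ) (ha : 0 < a)
    (h1 : -Real.sqrt a < X) (h2 : X < Real.sqrt a) (hb : b < 0)
    (c : ℝ) (hc : c = a - b * X)
    (X' a' A : ℝ) (hX' : X' = X - b / 2) (ha' : a' = b ^ 2 / 4 - b * X + a)
    (hA : A = a - X ^ 2)
    (V₁ V₂ : ℝ)
    (hV₁ : V₁ = a ^ 2 / 2 * (π / 2 - Real.arctan (X / Real.sqrt A)) +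
        (2 * X ^ 3 - 5 * a * X) / 6 * Real.sqrt A)
    (hV₂ : V₂ = a' ^ 2 / 2 * (π / 2 - Real.arctan (X' / Real.sqrt A)) +
        (2 * X' ^ 3 - 5 * a' * X') / 6 * Real.sqrt A) :
    (volume {p : ℝ × ℝ × ℝ |
        p.1 ^ 2 + p.2.1 ^ 2 ≤ p.2.2 ∧ p.2.2 ≤ a ∧ b * p.1 + c ≤ p.2.2}).toReal =
      V₁ - V₂ := by
  have hXa : X ^ 2 < a := Real.sq_lt.2 ⟨h1, h2⟩
  set P₁ : Set (ℝ × ℝ × ℝ) := {p | X ≤ p.1 ∧ p.1 ^ 2 + p.2.1 ^ 2 ≤ p.2.2 ∧ p.2.2 ≤ a} with hP₁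
  set P₂ : Set (ℝ × ℝ × ℝ) :=
    {p | X ≤ p.1 ∧ p.1 ^ 2 + p.2.1 ^ 2 ≤ p.2.2 ∧ p.2.2 < b * p.1 + c} with hP₂
  have hm₁ : MeasurableSet P₁ := by
    simp only [hP₁, Set.ofPred_and]
    refine (measurableSet_le ?_ ?_).inter ((measurableSet_le ?_ ?_).inter (measurableSet_le ?_ ?_))
      <;> fun_prop
  have hm₂ : MeasurableSet P₂ := by
    simp only [hP₂, Set.ofPred_and]
    refine (measurableSet_le ?_ ?_).inter ((measurableSet_le ?_ ?_).inter (measurableSet_lt ?_ ?_))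
      <;> fun_prop
  have hset : {p : ℝ × ℝ × ℝ |
      p.1 ^ 2 + p.2.1 ^ 2 ≤ p.2.2 ∧ p.2.2 ≤ a ∧ b * p.1 + c ≤ p.2.2} = P₁ \ P₂ := by
    ext ⟨x, y, z⟩
    simp only [hP₁, hP₂, Set.mem_ofPred_eq, Set.mem_sdiff, not_and, not_lt]
    constructor
    · rintro ⟨h, hza, hz⟩
      exact ⟨⟨by nlinarith, h, hza⟩, fun _ _ ↦ hz⟩
    · rintro ⟨⟨hx, h, hza⟩, hz⟩
      exact ⟨h, hza, hz hx h⟩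
  have hsub : P₂ ⊆ P₁ := by
    rintro ⟨x, y, z⟩ ⟨hx, h, hz⟩
    refine ⟨hx, h, ?_⟩
    simp only at hx hz ⊢
    nlinarith
  obtain ⟨hfin₁, hvol₁⟩ := volume_paraboloid_segment hm₁ (α := a) (h := 0) (X := X)
    (by simpa using hXa) (by
      intro x y
      split_ifs with hx
      · have : {z : ℝ | (x, y, z) ∈ P₁} = Set.Icc (x ^ 2 + y ^ 2) a := by
          ext z; simp [hP₁, hx]
        rw [this, Real.volume_Icc]
        congr 1; ring
      · simp [hP₁, hx])
  have hA' : a' - (X - b / 2) ^ 2 = A := by rw [ha', hA]; ring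
  obtain ⟨hfin₂, hvol₂⟩ := volume_paraboloid_segment hm₂ (α := a') (h := b / 2) (X := X)
    (by linarith) (by
      intro x y
      split_ifs with hx
      · have : {z : ℝ | (x, y, z) ∈ P₂} = Set.Ico (x ^ 2 + y ^ 2) (b * x + c) := by
          ext z; simp [hP₂, hx]
        rw [this, Real.volume_Ico]
        congr 1; rw [ha', hc]; ring
      · simp [hP₂, hx])
  rw [hset, measure_sdiff hsub hm₂.nullMeasurableSet hfin₂,
    ENNReal.toReal_sub_of_le (measure_mono hsub) hfin₁, hvol₁, hvol₂, hA', ← hX', hV₁, hV₂]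
  simp only [sub_zero, ← hA]
end

section
/- (Theorem 2(b).) Let a > 0 and X ∈ ℝ with −√(15/8) < X < 0 and −√a < X. Set A = a − X², P(b) = 6X·b³ + (21 − 10a)·b² − 36X·b + 12a + 18, and E(b) = (5b²/12 − 2bX/3 + 1/2)·V₂(b) + (2b/9)·A^{5/2} with V₂(b) = (a'²/2)(π/2 − arctan(X'/√A)) + ((2X'³ − 5a'X')/6)√A, X' = X − b/2, a' = b²/4 − bX + a. Then E(b) = 0 has a solution b < 0 only if P has two distinct negative zeros b̃₁ < b̃₂ < 0. If P has two distinct negative zeros b̃₁ < b̃₂, then: if E(b̃₂) = 0, then b̃₂ is the only solution b < 0 of E(b) = 0; if E(b̃₂) < 0, then E(b) = 0 has exactly two solutions b < 0, one in the open interval (b̃₁, b̃₂) and one in (b̃₂, 0); and if E(b̃₂) > 0, then E(b) = 0 has no solution b < 0. -/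
open Real

open Filter Topology

/-- The quadratic coefficient of the volume in the equilibrium function. -/
noncomputable def equilibriumQuad (X b : ℝ) : ℝ := 5 * b ^ 2 / 12 - 2 * b * X / 3 + 1 / 2

/-- The cubic governing the sign of the derivative of the normalized equilibrium function. -/
noncomputable def equilibriumCubic (a X b : ℝ) : ℝ :=
  6 * X * b ^ 3 + (21 - 10 * a) * b ^ 2 - 36 * X * b + 12 * a + 18

/-- The equilibrium function divided by `f * a' ^ 2`, with `s = √A`. -/
noncomputable def normalizedEquilibrium (s X b : ℝ) : ℝ :=
  (π / 2 - arctan ((X - b / 2) / s)) / 2 +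
    (2 * (X - b / 2) ^ 3 - 5 * (s ^ 2 + (X - b / 2) ^ 2) * (X - b / 2)) * s /
      (6 * (s ^ 2 + (X - b / 2) ^ 2) ^ 2) +
    2 * b * s ^ 5 / (9 * equilibriumQuad X b * (s ^ 2 + (X - b / 2) ^ 2) ^ 2)

theorem equilibriumQuad_ge (X b : ℝ) : 1 / 2 - 4 * X ^ 2 / 15 ≤ equilibriumQuad X b := by
  unfold equilibriumQuad
  nlinarith [sq_nonneg (5 * b - 4 * X)]

theorem hasDerivAt_normalizedEquilibrium {s X b : ℝ} (hs : 0 < s)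
    (hf : 0 < equilibriumQuad X b) :
    HasDerivAt (normalizedEquilibrium s X)
      (equilibriumCubic (s ^ 2 + X ^ 2) X b *
        (s ^ 5 / (108 * (s ^ 2 + (X - b / 2) ^ 2) ^ 3 * equilibriumQuad X b ^ 2))) b := by
  have hq : 0 < s ^ 2 + (X - b / 2) ^ 2 := by positivity
  have hx : HasDerivAt (fun b : ℝ => X - b / 2) (-(1 / 2)) b :=
    ((hasDerivAt_id b).div_const 2).const_sub X
  have hqd : HasDerivAt (fun b : ℝ => s ^ 2 + (X - b / 2) ^ 2)
      (2 * (X - b / 2) * (-(1 / 2))) b := by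
    refine HasDerivAt.congr_deriv (f := fun b : ℝ => s ^ 2 + (X - b / 2) ^ 2)
      ((hx.pow 2).const_add (s ^ 2)) ?_
    norm_num
  have hfd : HasDerivAt (equilibriumQuad X) (5 * b / 6 - 2 * X / 3) b := by
    have h := (((((hasDerivAt_id b).pow 2).const_mul 5).div_const 12).sub
      ((((hasDerivAt_id b).const_mul 2).mul_const X).div_const 3)).add_const (1 / 2)
    refine HasDerivAt.congr_deriv (f := equilibriumQuad X) h ?_
    simp only [id]
    ring
  have hd₁ : 6 * (s ^ 2 + (X - b / 2) ^ 2) ^ 2 ≠ 0 := by positivity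
  have hd₂ : 9 * equilibriumQuad X b * (s ^ 2 + (X - b / 2) ^ 2) ^ 2 ≠ 0 := by positivity
  have h := ((((hx.div_const s).arctan.const_sub (π / 2)).div_const 2).add
    (((((hx.pow 3).const_mul 2).sub ((hqd.const_mul 5).mul hx)).mul_const s).div
      ((hqd.pow 2).const_mul 6) hd₁)).add
    ((((hasDerivAt_id b).const_mul 2).mul_const (s ^ 5)).div
      ((hfd.const_mul 9).mul (hqd.pow 2)) hd₂)
  refine HasDerivAt.congr_deriv (f := normalizedEquilibrium s X) h ?_
  have hs' := hs.ne'
  have hf' := hf.ne'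
  have hq' := hq.ne'
  have harc : 1 / (1 + ((X - b / 2) / s) ^ 2) * (-(1 / 2) / s) =
      -s / (2 * (s ^ 2 + (X - b / 2) ^ 2)) := by
    have : 1 + ((X - b / 2) / s) ^ 2 = (s ^ 2 + (X - b / 2) ^ 2) / s ^ 2 := by field_simp
    rw [this]
    field_simp
  rw [harc]
  simp only [id, Pi.pow_apply, Pi.mul_apply, Pi.sub_apply]
  generalize hF : equilibriumQuad X b = F at *
  generalize hQ : s ^ 2 + (X - b / 2) ^ 2 = Q at *
  field_simp
  subst hF hQ
  unfold equilibriumCubic equilibriumQuad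
  ring

theorem tendsto_normalizedEquilibrium {s X : ℝ} (hs : 0 < s) (hX : 4 * X ^ 2 < 15 / 2) :
    Tendsto (normalizedEquilibrium s X) atBot (𝓝 0) := by
  have hx : Tendsto (fun b : ℝ => X - b / 2) atBot atTop := by
    have := tendsto_atTop_add_const_left atBot X
      ((tendsto_neg_atBot_atTop (G := ℝ)).atTop_div_const (zero_lt_two))
    refine this.congr fun b => by ring
  have hinv : Tendsto (fun b : ℝ => (X - b / 2)⁻¹) atBot (𝓝 0) := tendsto_inv_atTop_zero.comp hx
  have harc : Tendsto (fun b : ℝ => (π / 2 - arctan ((X - b / 2) / s)) / 2) atBot (𝓝 0) := by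
    have h := (tendsto_nhds_of_tendsto_nhdsWithin tendsto_arctan_atTop).comp
      (hx.atTop_div_const hs)
    simpa using (h.const_sub (π / 2)).div_const 2
  have hrat : Tendsto (fun b : ℝ =>
      (2 * (X - b / 2) ^ 3 - 5 * (s ^ 2 + (X - b / 2) ^ 2) * (X - b / 2)) * s /
      (6 * (s ^ 2 + (X - b / 2) ^ 2) ^ 2)) atBot (𝓝 0) := by
    refine squeeze_zero_norm' ?_ (by simpa using hinv.const_mul s)
    filter_upwards [hx.eventually_gt_atTop 0] with b hb
    generalize X - b / 2 = x at *
    rw [Real.norm_eq_abs, abs_div, abs_of_pos (by positivity : 0 < 6 * (s ^ 2 + x ^ 2) ^ 2),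
      abs_of_nonpos (by
        have : 0 ≤ (3 * x ^ 3 + 5 * s ^ 2 * x) * s := by positivity
        linarith), div_le_iff₀ (by positivity)]
    have : s * x⁻¹ * (6 * (s ^ 2 + x ^ 2) ^ 2) -
        -((2 * x ^ 3 - 5 * (s ^ 2 + x ^ 2) * x) * s) =
        s * x⁻¹ * (6 * s ^ 4 + 7 * s ^ 2 * x ^ 2 + 3 * x ^ 4) := by
      field_simp
      ring
    have : 0 ≤ s * x⁻¹ * (6 * s ^ 4 + 7 * s ^ 2 * x ^ 2 + 3 * x ^ 4) := by positivity
    linarith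
  set δ := 1 / 2 - 4 * X ^ 2 / 15 with hδ
  have hδ0 : 0 < δ := by rw [hδ]; linarith
  have hlast : Tendsto (fun b : ℝ =>
      2 * b * s ^ 5 / (9 * equilibriumQuad X b * (s ^ 2 + (X - b / 2) ^ 2) ^ 2))
      atBot (𝓝 0) := by
    refine squeeze_zero_norm' ?_
      (by simpa using hinv.const_mul (2 * (2 * |X| + 2) * s ^ 5 / (9 * δ)))
    filter_upwards [hx.eventually_ge_atTop 1] with b hb
    have hF : δ ≤ equilibriumQuad X b := equilibriumQuad_ge X b
    have hb' : |b| ≤ (2 * |X| + 2) * (X - b / 2) := by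
      have : |b| ≤ 2 * |X| + 2 * (X - b / 2) := by
        rw [abs_le]
        constructor <;> linarith [neg_abs_le X, le_abs_self X]
      nlinarith [abs_nonneg X]
    generalize X - b / 2 = x at *
    have hF0 : 0 < equilibriumQuad X b := hδ0.trans_le hF
    have hx0 : 0 < x := by linarith
    rw [Real.norm_eq_abs, abs_div, abs_mul, abs_mul, abs_of_pos (by positivity : 0 < s ^ 5),
      abs_of_pos (by norm_num : (0 : ℝ) < 2),
      abs_of_pos (by positivity :
        0 < 9 * equilibriumQuad X b * (s ^ 2 + x ^ 2) ^ 2)]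
    have hx2 : x * x ≤ (s ^ 2 + x ^ 2) ^ 2 := by
      have : 1 ≤ x ^ 2 := by nlinarith
      nlinarith [sq_nonneg s]
    calc 2 * |b| * s ^ 5 / (9 * equilibriumQuad X b * (s ^ 2 + x ^ 2) ^ 2)
        ≤ 2 * ((2 * |X| + 2) * x) * s ^ 5 / (9 * δ * (x * x)) := by gcongr
      _ = 2 * (2 * |X| + 2) * s ^ 5 / (9 * δ) * x⁻¹ := by field_simp
  have h := (harc.add hrat).add hlast
  simp only [add_zero] at h
  exact h

theorem StrictMonoOn.pos_of_tendsto_atBot {g : ℝ → ℝ} {c b : ℝ}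
    (hg : StrictMonoOn g (Set.Iic c)) (hlim : Tendsto g atBot (𝓝 0)) (hb : b ≤ c) : 0 < g b := by
  have h : 0 ≤ g (b - 1) := by
    refine le_of_tendsto hlim ?_
    filter_upwards [eventually_le_atBot (b - 1)] with y hy
    exact hg.monotoneOn (by simp only [Set.mem_Iic]; linarith)
      (by simp only [Set.mem_Iic]; linarith) hy
  exact h.trans_lt (hg (by simp only [Set.mem_Iic]; linarith) hb (by linarith))

theorem continuous_equilibriumCubic (a X : ℝ) : Continuous (equilibriumCubic a X) := by
  unfold equilibriumCubic
  fun_prop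

theorem equilibriumCubic_pos_of_le {a X b : ℝ} (ha : 0 < a) (hX : X < 0)
    (hb : b ≤ -4 + 10 * a / (3 * X)) : 0 < equilibriumCubic a X b := by
  have h0 : 10 * a / (3 * X) ≤ 0 := div_nonpos_of_nonneg_of_nonpos (by linarith) (by linarith)
  have h1 : 10 * a ≤ 3 * X * b := by
    have : 10 * a / (3 * X) * (3 * X) = 10 * a := div_mul_cancel₀ _ (by linarith)
    nlinarith
  have h2 : 12 ≤ b ^ 2 := by nlinarith
  have h3 : 0 ≤ (3 * X * b - 10 * a) * b ^ 2 := mul_nonneg (by linarith) (sq_nonneg b)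
  have h4 : 0 ≤ 3 * X * b * (b ^ 2 - 12) := mul_nonneg (by linarith) (by linarith)
  unfold equilibriumCubic
  nlinarith [sq_nonneg b]

theorem equilibriumCubic_eq_mul {a X b₁ b₂ : ℝ} (ha : 0 < a) (hX : X < 0)
    (h₁₂ : b₁ < b₂) (h₂ : b₂ < 0) (hP₁ : equilibriumCubic a X b₁ = 0)
    (hP₂ : equilibriumCubic a X b₂ = 0) {b : ℝ} (hb : b ≤ 0) :
    ∃ k > 0, equilibriumCubic a X b = (b - b₁) * (b - b₂) * k := by
  unfold equilibriumCubic at *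
  have hlin : -36 * X = 6 * X * (b₁ * b₂) - (b₁ + b₂) * (21 - 10 * a + 6 * X * (b₁ + b₂)) := by
    have : b₂ - b₁ ≠ 0 := by linarith
    apply mul_left_cancel₀ this
    linear_combination hP₂ - hP₁
  have hconst : b₁ * b₂ * (21 - 10 * a + 6 * X * (b₁ + b₂)) = 12 * a + 18 := by
    linear_combination b₁ * hlin - hP₁
  have hprod : 0 < b₁ * b₂ := mul_pos_of_neg_of_neg (h₁₂.trans h₂) h₂
  have hk : 0 < 21 - 10 * a + 6 * X * (b₁ + b₂) := by
    refine pos_of_mul_pos_right ?_ hprod.le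
    rw [hconst]
    linarith
  refine ⟨6 * X * b + (21 - 10 * a + 6 * X * (b₁ + b₂)), by nlinarith, ?_⟩
  linear_combination b * hlin - hconst

theorem equilibrium_eq_mul {s X b : ℝ} (hs : 0 < s) (hf : 0 < equilibriumQuad X b) :
    equilibriumQuad X b * ((s ^ 2 + (X - b / 2) ^ 2) ^ 2 / 2 *
      (π / 2 - arctan ((X - b / 2) / s)) +
        (2 * (X - b / 2) ^ 3 - 5 * (s ^ 2 + (X - b / 2) ^ 2) * (X - b / 2)) / 6 * s) +
        2 * b / 9 * s ^ 5 =
      equilibriumQuad X b * (s ^ 2 + (X - b / 2) ^ 2) ^ 2 * normalizedEquilibrium s X b := by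
  have : 0 < s ^ 2 + (X - b / 2) ^ 2 := by positivity
  unfold normalizedEquilibrium
  field_simp

theorem normalizedEquilibrium_zero_pos {s X : ℝ} (hs : 0 < s) (hX : X < 0) :
    0 < normalizedEquilibrium s X 0 := by
  have h1 : arctan (X / s) < π / 2 := arctan_lt_pi_div_two _
  have h2 : 0 < (2 * X ^ 3 - 5 * (s ^ 2 + X ^ 2) * X) * s := by
    have : 0 < (3 * X ^ 2 + 5 * s ^ 2) * (-X) * s := by
      have : 0 < -X := by linarith
      positivity
    linarith
  have h3 : 0 < (2 * X ^ 3 - 5 * (s ^ 2 + X ^ 2) * X) * s / (6 * (s ^ 2 + X ^ 2) ^ 2) :=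
    div_pos h2 (by positivity)
  simp only [normalizedEquilibrium, zero_div, sub_zero, mul_zero, zero_mul, add_zero]
  linarith

/-- Strict monotonicity from positivity of the derivative in the interior. -/
theorem strictMonoOn_of_hasDerivAt_pos {g g' : ℝ → ℝ} {D : Set ℝ} (hD : Convex ℝ D)
    (hg : ∀ b, HasDerivAt g (g' b) b) (h : ∀ b ∈ interior D, 0 < g' b) : StrictMonoOn g D :=
  strictMonoOn_of_deriv_pos hD (fun b _ => (hg b).continuousAt.continuousWithinAt)
    fun b hb => (hg b).deriv.symm ▸ h b hb

/-- The pattern of zeros on the negative axis of a function that is increasing, decreasing and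
increasing again there, tends to zero at `-∞` and is positive at `0`. -/
theorem negative_zeros_of_monotone_pieces {g : ℝ → ℝ} {b₁ b₂ : ℝ} (hc : Continuous g)
    (h₁₂ : b₁ < b₂) (h₂ : b₂ < 0) (hlim : Tendsto g atBot (𝓝 0)) (h0 : 0 < g 0)
    (hm₁ : StrictMonoOn g (Set.Iic b₁)) (hm₂ : StrictAntiOn g (Set.Icc b₁ b₂))
    (hm₃ : StrictMonoOn g (Set.Icc b₂ 0)) :
    (g b₂ = 0 → ∀ b < 0, g b = 0 → b = b₂) ∧
    (g b₂ < 0 → ∃ s₁ ∈ Set.Ioo b₁ b₂, ∃ s₂ ∈ Set.Ioo b₂ (0 : ℝ),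
      g s₁ = 0 ∧ g s₂ = 0 ∧ ∀ b < 0, g b = 0 → b = s₁ ∨ b = s₂) ∧
    (0 < g b₂ → ¬ ∃ b < 0, g b = 0) := by
  have hpos : ∀ b ≤ b₁, 0 < g b := fun b hb => hm₁.pos_of_tendsto_atBot hlim hb
  have hmin : ∀ b, b₁ ≤ b → b < 0 → b ≠ b₂ → g b₂ < g b := by
    intro b hb hb0 hne
    rcases lt_or_gt_of_ne hne with h | h
    · exact hm₂ ⟨hb, h.le⟩ ⟨h₁₂.le, le_rfl⟩ h
    · exact hm₃ ⟨le_rfl, h₂.le⟩ ⟨h.le, hb0.le⟩ h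
  have hloc : ∀ b, g b = 0 → b₁ < b := fun b hb => by
    by_contra! h
    exact (hpos b h).ne' hb
  refine ⟨fun hz b hb hgb => ?_, fun hneg => ?_, ?_⟩
  · by_contra hne
    have := hmin b (hloc b hgb).le hb hne
    linarith
  · obtain ⟨s₁, hs₁, hg₁⟩ :=
      intermediate_value_Ioo' h₁₂.le hc.continuousOn
        (⟨hneg, hpos b₁ le_rfl⟩ : (0 : ℝ) ∈ Set.Ioo _ _)
    obtain ⟨s₂, hs₂, hg₂⟩ :=
      intermediate_value_Ioo h₂.le hc.continuousOn (⟨hneg, h0⟩ : (0 : ℝ) ∈ Set.Ioo _ _)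
    refine ⟨s₁, hs₁, s₂, hs₂, hg₁, hg₂, fun b hb hgb => ?_⟩
    rcases le_total b b₂ with h | h
    · exact .inl (hm₂.injOn ⟨(hloc b hgb).le, h⟩ ⟨hs₁.1.le, hs₁.2.le⟩ (hgb.trans hg₁.symm))
    · exact .inr (hm₃.injOn ⟨h, hb.le⟩ ⟨hs₂.1.le, hs₂.2.le⟩ (hgb.trans hg₂.symm))
  · rintro hp ⟨b, hb, hgb⟩
    rcases eq_or_ne b b₂ with rfl | hne
    · exact hp.ne' hgb
    · have := hmin b (hloc b hgb).le hb hne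
      linarith

theorem stmt_10 (a X : ℝ) (ha : 0 < a)
    (h1 : -Real.sqrt a < X) (h2 : -Real.sqrt (15 / 8) < X) (h3 : X < 0)
    (A : ℝ) (hA : A = a - X ^ 2)
    (P : ℝ → ℝ)
    (hP : ∀ b, P b = 6 * X * b ^ 3 + (21 - 10 * a) * b ^ 2 - 36 * X * b + 12 * a + 18)
    (X' : ℝ → ℝ) (hX' : ∀ b, X' b = X - b / 2)
    (a' : ℝ → ℝ) (ha' : ∀ b, a' b = b ^ 2 / 4 - b * X + a)
    (V₂ : ℝ → ℝ)
    (hV₂ : ∀ b, V₂ b = a' b ^ 2 / 2 * (π / 2 - Real.arctan (X' b / Real.sqrt A)) +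
        (2 * X' b ^ 3 - 5 * a' b * X' b) / 6 * Real.sqrt A)
    (E : ℝ → ℝ)
    (hE : ∀ b, E b = (5 * b ^ 2 / 12 - 2 * b * X / 3 + 1 / 2) * V₂ b +
        2 * b / 9 * A ^ ((5 : ℝ) / 2)) :
    ((∃ b < 0, E b = 0) →
      ∃ bt₁ bt₂ : ℝ, bt₁ < bt₂ ∧ bt₂ < 0 ∧ P bt₁ = 0 ∧ P bt₂ = 0) ∧
    ∀ bt₁ bt₂ : ℝ, bt₁ < bt₂ → bt₂ < 0 → P bt₁ = 0 → P bt₂ = 0 →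
      ((E bt₂ = 0 → ∀ b < 0, E b = 0 → b = bt₂) ∧
       (E bt₂ < 0 →
         ∃ s₁ ∈ Set.Ioo bt₁ bt₂, ∃ s₂ ∈ Set.Ioo bt₂ (0 : ℝ),
           E s₁ = 0 ∧ E s₂ = 0 ∧ ∀ b < 0, E b = 0 → b = s₁ ∨ b = s₂) ∧
       (0 < E bt₂ → ¬ ∃ b < 0, E b = 0)) := by
  have hXa : X ^ 2 < a := by
    have := Real.sq_sqrt ha.le
    nlinarith [Real.sqrt_nonneg a]
  have hX15 : 4 * X ^ 2 < 15 / 2 := by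
    have := Real.sq_sqrt (show (0 : ℝ) ≤ 15 / 8 by norm_num)
    nlinarith [Real.sqrt_nonneg (15 / 8 : ℝ)]
  have hA0 : 0 < A := by linarith
  obtain ⟨s, hs_def⟩ : ∃ s, s = √A := ⟨_, rfl⟩
  have hs : 0 < s := hs_def ▸ Real.sqrt_pos.2 hA0
  have hsA : s ^ 2 = A := hs_def ▸ Real.sq_sqrt hA0.le
  have hs5 : A ^ ((5 : ℝ) / 2) = s ^ 5 := by
    rw [← hsA, ← Real.rpow_natCast, ← Real.rpow_natCast, ← Real.rpow_mul hs.le]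
    norm_num
  have ha_eq : s ^ 2 + X ^ 2 = a := by linarith
  have hf : ∀ b, 0 < equilibriumQuad X b := fun b =>
    lt_of_lt_of_le (by linarith) (equilibriumQuad_ge X b)
  set g := normalizedEquilibrium s X with hg
  have hEg : ∀ b, ∃ k > 0, E b = k * g b := fun b => by
    refine ⟨_, mul_pos (hf b) (pow_pos (by positivity : 0 < s ^ 2 + (X - b / 2) ^ 2) 2), ?_⟩
    rw [hg, ← equilibrium_eq_mul hs (hf b), hE, hV₂, hX', hs5, ← hs_def,
      show a' b = s ^ 2 + (X - b / 2) ^ 2 by rw [ha']; linarith]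
    rfl
  have hE0 : ∀ b, E b = 0 ↔ g b = 0 := fun b => by
    obtain ⟨k, hk, h⟩ := hEg b
    rw [h, mul_eq_zero_iff_left hk.ne']
  have hEneg : ∀ b, E b < 0 ↔ g b < 0 := fun b => by
    obtain ⟨k, hk, h⟩ := hEg b
    rw [h, ← neg_pos, ← mul_neg, mul_pos_iff_of_pos_left hk, neg_pos]
  have hEpos : ∀ b, 0 < E b ↔ 0 < g b := fun b => by
    obtain ⟨k, hk, h⟩ := hEg b
    rw [h, mul_pos_iff_of_pos_left hk]
  obtain rfl : P = equilibriumCubic a X := funext hP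
  obtain ⟨w, hw, hderiv⟩ : ∃ w : ℝ → ℝ, (∀ b, 0 < w b) ∧
      ∀ b, HasDerivAt g (equilibriumCubic a X b * w b) b := by
    refine ⟨_, fun b => ?_, fun b => ha_eq ▸ hasDerivAt_normalizedEquilibrium hs (hf b)⟩
    have := hf b
    positivity
  have hlim : Tendsto g atBot (𝓝 0) := tendsto_normalizedEquilibrium hs hX15
  have hPc := continuous_equilibriumCubic a X
  simp only [hE0, hEneg, hEpos]
  refine ⟨?_, fun b₁ b₂ h₁₂ hb₂ hP₁ hP₂ => ?_⟩
  · rintro ⟨b, hb, hgb⟩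
    set c := -4 + 10 * a / (3 * X) with hc
    have hPc_pos : ∀ y ≤ c, 0 < equilibriumCubic a X y := fun y hy =>
      equilibriumCubic_pos_of_le ha h3 hy
    have hmono : StrictMonoOn g (Set.Iic c) := by
      refine strictMonoOn_of_hasDerivAt_pos (convex_Iic c) hderiv fun y hy => ?_
      rw [interior_Iic] at hy
      exact mul_pos (hPc_pos y (le_of_lt hy)) (hw y)
    have hgc : ∀ y ≤ c, 0 < g y := fun y hy => hmono.pos_of_tendsto_atBot hlim hy
    have hcb : c < b := by
      by_contra! h
      exact (hgc b h).ne' hgb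
    obtain ⟨y, hy, hPy⟩ : ∃ y ∈ Set.Ioo c b, equilibriumCubic a X y < 0 := by
      obtain ⟨y, hy, hslope⟩ := exists_hasDerivAt_eq_slope g _ hcb
        (fun y _ => (hderiv y).continuousAt.continuousWithinAt) fun y _ => hderiv y
      refine ⟨y, hy, neg_of_mul_neg_left ?_ (hw y).le⟩
      rw [hslope, hgb]
      exact div_neg_of_neg_of_pos (by linarith [hgc c le_rfl]) (by linarith)
    obtain ⟨b₁, hb₁, hz₁⟩ := intermediate_value_Ioo' hy.1.le hPc.continuousOn
      (⟨hPy, hPc_pos c le_rfl⟩ : (0 : ℝ) ∈ Set.Ioo _ _)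
    obtain ⟨b₂, hb₂, hz₂⟩ := intermediate_value_Ioo (hy.2.trans hb).le hPc.continuousOn
      (⟨hPy, by simp only [equilibriumCubic]; linarith⟩ : (0 : ℝ) ∈ Set.Ioo _ _)
    exact ⟨b₁, b₂, hb₁.2.trans hb₂.1, hb₂.2, hz₁, hz₂⟩
  · have hfac := fun b hb => equilibriumCubic_eq_mul (b := b) ha h3 h₁₂ hb₂ hP₁ hP₂ hb
    refine negative_zeros_of_monotone_pieces
      (continuous_iff_continuousAt.2 fun b => (hderiv b).continuousAt) h₁₂ hb₂ hlim
      (normalizedEquilibrium_zero_pos hs h3) ?_ ?_ ?_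
    · refine strictMonoOn_of_hasDerivAt_pos (convex_Iic b₁) hderiv fun b hb => ?_
      rw [interior_Iic, Set.mem_Iio] at hb
      obtain ⟨k, hk, h⟩ := hfac b (by linarith)
      rw [h]
      exact mul_pos (mul_pos (mul_pos_of_neg_of_neg (by linarith) (by linarith)) hk) (hw b)
    · refine strictAntiOn_of_deriv_neg (convex_Icc b₁ b₂)
        (fun b _ => (hderiv b).continuousAt.continuousWithinAt) fun b hb => ?_
      rw [interior_Icc] at hb
      obtain ⟨k, hk, h⟩ := hfac b (by linarith [hb.2])
      rw [(hderiv b).deriv, h]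
      exact mul_neg_of_neg_of_pos (mul_neg_of_neg_of_pos
        (mul_neg_of_pos_of_neg (by linarith [hb.1]) (by linarith [hb.2])) hk) (hw b)
    · refine strictMonoOn_of_hasDerivAt_pos (convex_Icc b₂ 0) hderiv fun b hb => ?_
      rw [interior_Icc] at hb
      obtain ⟨k, hk, h⟩ := hfac b hb.2.le
      rw [h]
      exact mul_pos (mul_pos (mul_pos (by linarith [hb.1]) (by linarith [hb.1])) hk) (hw b)
end

section
/- Let a > 0, 0 < σ < 1, V = a²π/2, and let X ∈ ℝ with −√a < X < √a and b < 0. Set A = a − X², X' = X − b/2, a' = b²/4 − bX + a, β = √(b² + 1), V₁ = (a²/2)(π/2 − arctan(X/√A)) + ((2X³ − 5aX)/6)√A, V₂ = (a'²/2)(π/2 − arctan(X'/√A)) + ((2X'³ − 5a'X')/6)√A, E = (5b²/12 − 2bX/3 + 1/2)·V₂ + (2b/9)·A^{5/2}, F = V₁ − V₂ − σV, and define U(X,b) = (1/β)·((a/3 − bX)·(σV − V₁) + (a'/3)·V₂ − (2b/9)·A^{5/2}). Then the partial derivatives of U satisfy ∂U/∂X = b·F/β and ∂U/∂b = (1/β³)·(b·E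 + (X + ba/3)·F). In particular, (X,b) is a stationary point of U if and only if E = 0 and F = 0. -/
open Real

/-- The submerged volume profile, in terms of the abscissa `x` and the half-width `s`. -/
noncomputable def segmentVolume (x s : ℝ) : ℝ :=
  (s ^ 2 + x ^ 2) ^ 2 / 2 * (π / 2 - arctan (x / s)) +
    (2 * x ^ 3 - 5 * (s ^ 2 + x ^ 2) * x) / 6 * s

theorem hasDerivAt_segmentVolume {x s : ℝ → ℝ} {x' s' t : ℝ}
    (hx : HasDerivAt x x' t) (hs : HasDerivAt s s' t) (h0 : s t ≠ 0) :
    HasDerivAt (fun u => segmentVolume (x u) (s u))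
      ((2 * x t * (s t ^ 2 + x t ^ 2) * (π / 2 - arctan (x t / s t)) -
          (4 / 3 * s t ^ 2 + 2 * x t ^ 2) * s t) * x' +
        (2 * s t * (s t ^ 2 + x t ^ 2) * (π / 2 - arctan (x t / s t)) -
          2 * s t ^ 2 * x t) * s') t := by
  have hp := (hs.pow 2).add (hx.pow 2)
  have hT := ((hx.div hs h0).arctan).const_sub (π / 2)
  have h := (((hp.pow 2).div_const 2).mul hT).add
    (((((hx.pow 3).const_mul 2).sub ((hp.const_mul 5).mul hx)).div_const 6).mul hs)
  refine h.congr_deriv ?_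
  simp only [Pi.add_apply, Pi.pow_apply, Pi.mul_apply, Pi.div_apply, Pi.sub_apply]
  have hpos : s t ^ 2 + x t ^ 2 ≠ 0 := by positivity
  have hden : 1 / (1 + (x t / s t) ^ 2) * ((x' * s t - x t * s') / s t ^ 2) =
      (x' * s t - x t * s') / (s t ^ 2 + x t ^ 2) := by
    field_simp
  rw [hden]
  generalize arctan (x t / s t) = T
  field_simp
  ring

theorem rpow_five_halves_eq_sqrt_pow {y : ℝ} (hy : 0 ≤ y) : y ^ ((5 : ℝ) / 2) = √y ^ 5 := by
  rw [sqrt_eq_rpow, ← rpow_natCast, ← rpow_mul hy]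
  norm_num

theorem stmt_16 (a σ : ℝ) (ha : 0 < a) (hσ0 : 0 < σ) (hσ1 : σ < 1)
    (V : ℝ) (hV : V = a ^ 2 * π / 2)
    (β : ℝ → ℝ) (hβ : ∀ b, β b = Real.sqrt (b ^ 2 + 1))
    (A : ℝ → ℝ) (hA : ∀ X, A X = a - X ^ 2)
    (X' : ℝ → ℝ → ℝ) (hX' : ∀ X b, X' X b = X - b / 2)
    (a' : ℝ → ℝ → ℝ) (ha' : ∀ X b, a' X b = b ^ 2 / 4 - b * X + a)
    (V₁ : ℝ → ℝ)
    (hV₁ : ∀ X, V₁ X = a ^ 2 / 2 * (π / 2 - Real.arctan (X / Real.sqrt (A X))) +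
        (2 * X ^ 3 - 5 * a * X) / 6 * Real.sqrt (A X))
    (V₂ : ℝ → ℝ → ℝ)
    (hV₂ : ∀ X b, V₂ X b =
        a' X b ^ 2 / 2 * (π / 2 - Real.arctan (X' X b / Real.sqrt (A X))) +
        (2 * X' X b ^ 3 - 5 * a' X b * X' X b) / 6 * Real.sqrt (A X))
    (E : ℝ → ℝ → ℝ)
    (hE : ∀ X b, E X b = (5 * b ^ 2 / 12 - 2 * b * X / 3 + 1 / 2) * V₂ X b +
        2 * b / 9 * A X ^ ((5 : ℝ) / 2))
    (F : ℝ → ℝ → ℝ)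
    (hF : ∀ X b, F X b = V₁ X - V₂ X b - σ * V)
    (U : ℝ → ℝ → ℝ)
    (hU : ∀ X b, U X b = 1 / β b *
        ((a / 3 - b * X) * (σ * V - V₁ X) + a' X b / 3 * V₂ X b -
          2 * b / 9 * A X ^ ((5 : ℝ) / 2))) :
    ∀ X b : ℝ, -Real.sqrt a < X → X < Real.sqrt a → b < 0 →
      HasDerivAt (fun X0 => U X0 b) (b * F X b / β b) X ∧
      HasDerivAt (fun b0 => U X b0)
        (1 / β b ^ 3 * (b * E X b + (X + b * a / 3) * F X b)) b ∧
      ((HasDerivAt (fun X0 => U X0 b) 0 X ∧ HasDerivAt (fun b0 => U X b0) 0 b) ↔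
        (E X b = 0 ∧ F X b = 0)) := by
  intro X b hX1 hX2 hb
  have hpos : 0 < a - X ^ 2 := sub_pos.2 (Real.sq_lt.2 ⟨hX1, hX2⟩)
  have hβpos : 0 < √(b ^ 2 + 1) := Real.sqrt_pos.2 (by positivity)
  have hβsq : √(b ^ 2 + 1) ^ 2 = b ^ 2 + 1 := Real.sq_sqrt (by positivity)
  have hV₁' : ∀ X, 0 ≤ a - X ^ 2 → V₁ X = segmentVolume X √(a - X ^ 2) := by
    intro X h
    rw [hV₁, hA, segmentVolume, Real.sq_sqrt h]
    ring
  have hp : ∀ X b, 0 ≤ a - X ^ 2 → a' X b = √(a - X ^ 2) ^ 2 + (X - b / 2) ^ 2 := by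
    intro X b h
    rw [ha', Real.sq_sqrt h]
    ring
  have hV₂' : ∀ X b, 0 ≤ a - X ^ 2 → V₂ X b = segmentVolume (X - b / 2) √(a - X ^ 2) := by
    intro X b h
    rw [hV₂, hA, hX', hp X b h, segmentVolume]
  have hU' : ∀ X b, 0 ≤ a - X ^ 2 → U X b = 1 / √(b ^ 2 + 1) *
      ((a / 3 - b * X) * (σ * V - segmentVolume X √(a - X ^ 2)) +
        (b ^ 2 / 4 - b * X + a) / 3 * segmentVolume (X - b / 2) √(a - X ^ 2) -
        2 * b / 9 * √(a - X ^ 2) ^ 5) := by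
    intro X b h
    rw [hU, hV₁' X h, hV₂' X b h, hβ, ha', hA, rpow_five_halves_eq_sqrt_pow h]
  have hs0 : √(a - X ^ 2) ≠ 0 := (Real.sqrt_pos.2 hpos).ne'
  have hsq : √(a - X ^ 2) ^ 2 = a - X ^ 2 := Real.sq_sqrt hpos.le
  have hdX : HasDerivAt (fun X0 => U X0 b) (b * F X b / β b) X := by
    have hs : HasDerivAt (fun t : ℝ => √(a - t ^ 2)) (-X / √(a - X ^ 2)) X := by
      refine (((hasDerivAt_pow 2 X).const_sub a).sqrt hpos.ne').congr_deriv ?_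
      field_simp
      ring
    have hW₁ := hasDerivAt_segmentVolume (hasDerivAt_id' X) hs hs0
    have hW₂ := hasDerivAt_segmentVolume ((hasDerivAt_id' X).sub_const (b / 2)) hs hs0
    have hlin : HasDerivAt (fun t : ℝ => b * t) b X := by
      simpa using (hasDerivAt_id' X).const_mul b
    have h := (((((hlin.const_sub (a / 3)).mul (hW₁.const_sub (σ * V))).add
      ((((hlin.const_sub (b ^ 2 / 4)).add_const a).div_const 3).mul hW₂)).sub
      ((hs.pow 5).const_mul (2 * b / 9))).const_mul (1 / √(b ^ 2 + 1)))
    refine (h.congr_of_eventuallyEq ?_).congr_deriv ?_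
    · have hev : ∀ᶠ t in nhds X, 0 < a - t ^ 2 :=
        (continuous_const.sub (continuous_pow 2)).continuousAt.eventually_const_lt hpos
      filter_upwards [hev] with t ht
      exact hU' t b ht.le
    · rw [hF, hV₁' X hpos.le, hV₂' X b hpos.le, hβ]
      simp only [segmentVolume]
      generalize √(a - X ^ 2) = s at *
      obtain rfl : a = s ^ 2 + X ^ 2 := by linarith
      generalize arctan (X / s) = T₁
      generalize arctan ((X - b / 2) / s) = T₂
      field_simp
      ring
  have hdb : HasDerivAt (fun b0 => U X b0)
      (1 / β b ^ 3 * (b * E X b + (X + b * a / 3) * F X b)) b := by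
    have hβ' : HasDerivAt (fun t : ℝ => 1 / √(t ^ 2 + 1)) (-b / √(b ^ 2 + 1) ^ 3) b := by
      have h := (((hasDerivAt_pow 2 b).add_const 1).sqrt (by positivity)).inv hβpos.ne'
      simp only [one_div]
      refine h.congr_deriv ?_
      field_simp
      norm_num
    have hid := hasDerivAt_id' b
    have hlin : HasDerivAt (fun t : ℝ => t * X) X b := by
      simpa using hid.mul_const X
    have hW₂ := hasDerivAt_segmentVolume ((hid.div_const 2).const_sub X)
      (hasDerivAt_const b √(a - X ^ 2)) hs0
    have h := hβ'.mul ((((hlin.const_sub (a / 3)).mul_const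
      (σ * V - segmentVolume X √(a - X ^ 2))).add
      ((((((hid.pow 2).div_const 4).sub hlin).add_const a).div_const 3).mul hW₂)).sub
      (((hid.const_mul 2).div_const 9).mul_const (√(a - X ^ 2) ^ 5)))
    refine (h.congr_of_eventuallyEq (.of_forall fun t => hU' X t hpos.le)).congr_deriv ?_
    rw [hF, hE, hV₁' X hpos.le, hV₂' X b hpos.le, hβ, hA,
      rpow_five_halves_eq_sqrt_pow hpos.le]
    simp only [Pi.add_apply, Pi.pow_apply, Pi.mul_apply, Pi.sub_apply]
    generalize √(b ^ 2 + 1) = r at *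
    simp only [segmentVolume]
    generalize √(a - X ^ 2) = s at *
    obtain rfl : a = s ^ 2 + X ^ 2 := by linarith
    generalize arctan (X / s) = T₁
    generalize arctan ((X - b / 2) / s) = T₂
    field_simp
    rw [hβsq]
    ring
  refine ⟨hdX, hdb, ?_⟩
  have hβ0 : β b ≠ 0 := by rw [hβ]; exact hβpos.ne'
  constructor
  · rintro ⟨h1, h2⟩
    have hF0 : F X b = 0 := by simpa [hb.ne, hβ0] using hdX.unique h1
    have hE0 : E X b = 0 := by simpa [hF0, hb.ne, hβ0] using hdb.unique h2
    exact ⟨hE0, hF0⟩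
  · rintro ⟨hE0, hF0⟩
    exact ⟨by simpa [hF0] using hdX, by simpa [hE0, hF0] using hdb⟩
end
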